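/- Let G be a finite group with at least two elements and μ a probability measure on G with μ(1) > 0 whose support generates G. Then (G,μ) is entropy noise sensitive. -/

import Mathlib

open Filter

namespace NS

/-- A probability measure on a countable (discrete) set, as a nonnegative
function summing to 1. -/
def IsProbMeasure {E : Type*} (ξ : E → ℝ) : Prop :=
  (∀ x, 0 ≤ ξ x) ∧ ∑' x, ξ x = 1

/-- Convolution of two measures on a group. -/
noncomputable def conv {G : Type*} [Group G] (μ ν : G → ℝ) : G → ℝ :=
  fun g => ∑' h, μ h * ν (h⁻¹ * g)

/-- `convPow μ n` is the `n`-fold convolution `μ^{*n}`, the law of the random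
walk at time `n` (with `μ^{*0}` the Dirac mass at the identity). -/
noncomputable def convPow {G : Type*} [Group G] (μ : G → ℝ) : ℕ → G → ℝ
  | 0 => ({1} : Set G).indicator (fun _ => (1 : ℝ))
  | n + 1 => conv μ (convPow μ n)

/-- The diagonal measure `μ^diag` on `G × G`. -/
noncomputable def diagM {G : Type*} [Group G] (μ : G → ℝ) : G × G → ℝ :=
  {p : G × G | p.1 = p.2}.indicator (fun p => μ p.1)

/-- Product of two measures. -/
def prodM {G H : Type*} (μ : G → ℝ) (ν : H → ℝ) : G × H → ℝ :=
  fun p => μ p.1 * ν p.2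

/-- The noise kernel `π^ρ = (1-ρ)·μ^diag + ρ·(μ×μ)` on `G × G`. -/
noncomputable def noise {G : Type*} [Group G] (μ : G → ℝ) (ρ : ℝ) : G × G → ℝ :=
  fun p => (1 - ρ) * diagM μ p + ρ * prodM μ μ p

/-- The `ℓ¹` distance between two measures. -/
noncomputable def l1dist {E : Type*} (ξ₁ ξ₂ : E → ℝ) : ℝ :=
  ∑' x, |ξ₁ x - ξ₂ x|

/-- `(G,μ)` is `ℓ¹`-noise sensitive. -/
def L1NoiseSensitive {G : Type*} [Group G] (μ : G → ℝ) : Prop :=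
  ∀ ρ ∈ Set.Ioo (0 : ℝ) 1,
    Tendsto
      (fun n => l1dist (convPow (noise μ ρ) n) (prodM (convPow μ n) (convPow μ n)))
      atTop (nhds 0)

/-- Shannon entropy of a measure. -/
noncomputable def entropy {E : Type*} (ξ : E → ℝ) : ℝ :=
  -∑' x, ξ x * Real.log (ξ x)

/-- `(G,μ)` is entropy noise sensitive: `H(Y_n^ρ | X_n) / H(X_n) → 1`, where
`H(Y_n^ρ | X_n) = H(π_n^ρ) - H(μ_n)`. -/
def EntropyNoiseSensitive {G : Type*} [Group G] (μ : G → ℝ) : Prop :=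
  ∀ ρ ∈ Set.Ioo (0 : ℝ) 1,
    Tendsto
      (fun n => (entropy (convPow (noise μ ρ) n) - entropy (convPow μ n))
        / entropy (convPow μ n))
      atTop (nhds 1)

/-- A function is `μ`-harmonic. -/
def Harmonic {G : Type*} [Group G] (μ : G → ℝ) (f : G → ℝ) : Prop :=
  ∀ y, f y = ∑' x, μ x * f (y * x)

/-- `(G,μ)` is Liouville: every bounded `μ`-harmonic function is constant. -/
def Liouville {G : Type*} [Group G] (μ : G → ℝ) : Prop :=
  ∀ f : G → ℝ, Harmonic μ f → (∃ C, ∀ g, |f g| ≤ C) → ∀ x y, f x = f y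

/-- Word distance for a generating set `S`: least length of a word in `S`
evaluating to `x⁻¹ * y`. -/
noncomputable def wordDist {G : Type*} [Group G] (S : Set G) (x y : G) : ℕ :=
  sInf {n : ℕ | ∃ w : List G, w.length = n ∧ (∀ g ∈ w, g ∈ S) ∧ w.prod = x⁻¹ * y}

/-- Expected distance `E d(X_n, X'_n)` between two independent samples of law `ξ`. -/
noncomputable def spread {G : Type*} [Group G] (S : Set G) (ξ : G → ℝ) : ℝ :=
  ∑' p : G × G, ξ p.1 * ξ p.2 * (wordDist S p.1 p.2 : ℝ)

/-- Expected distance between the two coordinates under a measure on `G × G`. -/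
noncomputable def avgDist {G : Type*} [Group G] (S : Set G) (π : G × G → ℝ) : ℝ :=
  ∑' p : G × G, π p * (wordDist S p.1 p.2 : ℝ)

/-- `ν` is a coupling of `ξ₁` and `ξ₂`. -/
def IsCoupling {E₁ E₂ : Type*} (ν : E₁ × E₂ → ℝ) (ξ₁ : E₁ → ℝ) (ξ₂ : E₂ → ℝ) : Prop :=
  (∀ p, 0 ≤ ν p) ∧ (∀ x, ∑' y, ν (x, y) = ξ₁ x) ∧ (∀ y, ∑' x, ν (x, y) = ξ₂ y)

/-- `U^s(ξ₁,ξ₂)`: infimum over couplings `ν` of `ν(d(x,y) ≥ s)`. -/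
noncomputable def Ufn {E₁ E₂ : Type*} (d : E₁ → E₂ → ℝ) (s : ℝ)
    (ξ₁ : E₁ → ℝ) (ξ₂ : E₂ → ℝ) : ℝ :=
  sInf {r : ℝ | ∃ ν : E₁ × E₂ → ℝ, IsCoupling ν ξ₁ ξ₂ ∧
    r = ∑' p : E₁ × E₂, {q : E₁ × E₂ | s ≤ d q.1 q.2}.indicator ν p}

/-- The `ℓ¹` product metric on `G × G` associated to the word metric of `S`. -/
noncomputable def wordDistProd {G : Type*} [Group G] (S : Set G) :
    G × G → G × G → ℝ :=
  fun p q => (wordDist S p.1 q.1 : ℝ) + (wordDist S p.2 q.2 : ℝ)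

section helpers

variable {K : Type*} [Group K] [Fintype K]

lemma conv_apply (a b : K → ℝ) (g : K) : conv a b g = ∑ h, a h * b (h⁻¹ * g) := by
  simp [conv, tsum_fintype]

lemma conv_assoc' (a b f : K → ℝ) : conv (conv a b) f = conv a (conv b f) := by
  funext g
  simp only [conv_apply, Finset.sum_mul, Finset.mul_sum]
  rw [Finset.sum_comm]
  refine Finset.sum_congr rfl fun h _ => ?_
  rw [← Equiv.sum_comp (Equiv.mulLeft h)]
  refine Finset.sum_congr rfl fun k _ => ?_
  simp [mul_assoc]

lemma conv_one' (b : K → ℝ) : conv (convPow b 0) b = b ∧ ∀ f : K → ℝ, conv (convPow b 0) f = f := by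
  classical
  have : ∀ f : K → ℝ, conv (convPow b 0) f = f := by
    intro f
    funext g
    rw [conv_apply, Finset.sum_eq_single 1]
    · simp [convPow]
    · intro h _ hh
      simp [convPow, hh]
    · simp
  exact ⟨this b, this⟩

lemma convPow_add' (ν : K → ℝ) (m n : ℕ) :
    convPow ν (m + n) = conv (convPow ν m) (convPow ν n) := by
  induction m with
  | zero => rw [(conv_one' ν).2, Nat.zero_add]
  | succ m ih =>
    rw [Nat.add_right_comm]
    change conv ν (convPow ν (m + n)) = conv (conv ν (convPow ν m)) _
    rw [ih, conv_assoc']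

lemma sum_conv (a b : K → ℝ) : ∑ g, conv a b g = (∑ g, a g) * ∑ g, b g := by
  simp only [conv_apply]
  rw [Finset.sum_comm, Finset.sum_mul]
  refine Finset.sum_congr rfl fun h _ => ?_
  rw [← Finset.mul_sum]
  congr 1
  exact Equiv.sum_comp (Equiv.mulLeft h⁻¹) b

lemma convPow_nonneg (ν : K → ℝ) (h0 : ∀ x, 0 ≤ ν x) (n : ℕ) (g : K) : 0 ≤ convPow ν n g := by
  induction n generalizing g with
  | zero => exact Set.indicator_nonneg (fun _ _ => zero_le_one) _
  | succ n ih =>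
    change 0 ≤ conv ν _ g
    rw [conv_apply]
    exact Finset.sum_nonneg fun h _ => mul_nonneg (h0 h) (ih _)

lemma convPow_sum (ν : K → ℝ) (h1 : ∑ x, ν x = 1) (n : ℕ) : ∑ g, convPow ν n g = 1 := by
  classical
  induction n with
  | zero => simp [convPow, Set.indicator_apply]
  | succ n ih =>
    change ∑ g, conv ν _ g = 1
    rw [sum_conv, h1, ih, one_mul]

lemma convPow_step (ν : K → ℝ) (h0 : ∀ x, 0 ≤ ν x) (n : ℕ) (x y : K) :
    ν x * convPow ν n y ≤ convPow ν (n + 1) (x * y) := by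
  change _ ≤ conv ν _ _
  rw [conv_apply]
  have := Finset.single_le_sum (f := fun h => ν h * convPow ν n (h⁻¹ * (x * y)))
    (fun h _ => mul_nonneg (h0 h) (convPow_nonneg ν h0 n _)) (Finset.mem_univ x)
  simpa using this

lemma exists_pos (ν : K → ℝ) (h0 : ∀ x, 0 ≤ ν x) (hl : 0 < ν 1)
    (hgen : Subgroup.closure (Function.support ν) = ⊤) :
    ∃ N, ∀ g, 0 < convPow ν N g := by
  have mono : ∀ g n m, n ≤ m → 0 < convPow ν n g → 0 < convPow ν m g := by
    intro g n m hnm hn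
    induction m, hnm using Nat.le_induction with
    | base => exact hn
    | succ m _ ih =>
      have := convPow_step ν h0 m 1 g
      rw [one_mul] at this
      exact lt_of_lt_of_le (mul_pos hl ih) this
  have ex : ∀ g, ∃ n, 0 < convPow ν n g := by
    intro g
    have hg : g ∈ Submonoid.closure (Function.support ν) := by
      rw [← Subgroup.closure_toSubmonoid_of_finite, hgen]; trivial
    induction hg using Submonoid.closure_induction_left with
    | one => exact ⟨0, by simp [convPow]⟩
    | mul_left x hx y _ ih =>
      obtain ⟨n, hn⟩ := ih
      exact ⟨n + 1, lt_of_lt_of_le (mul_pos (lt_of_le_of_ne (h0 x) (Ne.symm hx)) hn)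
        (convPow_step ν h0 n x y)⟩
  choose f hf using ex
  exact ⟨∑ g, f g, fun g => mono g _ _
    (Finset.single_le_sum (fun _ _ => Nat.zero_le _) (Finset.mem_univ g)) (hf g)⟩

lemma contract (p d : K → ℝ) (ε : ℝ) (hp : ∀ x, ε ≤ p x) (h1 : ∑ x, p x = 1)
    (hd : ∑ x, d x = 0) :
    ∑ g, |conv p d g| ≤ (1 - Fintype.card K * ε) * ∑ g, |d g| := by
  have hs : ∀ g, conv p d g = conv (fun x => p x - ε) d g := by
    intro g
    have : ∑ h : K, d (h⁻¹ * g) = 0 := by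
      rw [← hd]
      exact Equiv.sum_comp ((Equiv.inv K).trans (Equiv.mulRight g)) d
    simp only [conv_apply, sub_mul, Finset.sum_sub_distrib, ← Finset.mul_sum, this]
    simp
  calc ∑ g, |conv p d g| ≤ ∑ g, conv (fun x => p x - ε) (fun x => |d x|) g := by
        refine Finset.sum_le_sum fun g _ => ?_
        rw [hs, conv_apply, conv_apply]
        refine (Finset.abs_sum_le_sum_abs _ _).trans_eq ?_
        refine Finset.sum_congr rfl fun h _ => ?_
        rw [abs_mul, abs_of_nonneg (sub_nonneg.2 (hp h))]
    _ = _ := by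
        rw [sum_conv]
        simp [Finset.sum_sub_distrib, h1]

lemma convPow_tendsto (ν : K → ℝ) (h0 : ∀ x, 0 ≤ ν x) (h1 : ∑ x, ν x = 1) (hl : 0 < ν 1)
    (hgen : Subgroup.closure (Function.support ν) = ⊤) (g : K) :
    Tendsto (fun n => convPow ν n g) atTop (nhds ((Fintype.card K : ℝ)⁻¹)) := by
  have hc : (Fintype.card K : ℝ) ≠ 0 := by exact_mod_cast Fintype.card_ne_zero
  set c : ℝ := (Fintype.card K : ℝ)⁻¹ with hcdef
  set d : ℕ → K → ℝ := fun n x => convPow ν n x - c with hddef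
  have hd0 : ∀ n, ∑ x, d n x = 0 := by
    intro n
    simp [hddef, Finset.sum_sub_distrib, convPow_sum ν h1, hcdef, hc]
  have hdadd : ∀ m n, d (m + n) = conv (convPow ν m) (d n) := by
    intro m n
    funext x
    simp only [hddef, convPow_add', conv_apply, mul_sub, Finset.sum_sub_distrib,
      ← Finset.sum_mul, convPow_sum ν h1, one_mul]
  set e : ℕ → ℝ := fun n => ∑ x, |d n x| with hedef
  have he0 : ∀ n, 0 ≤ e n := fun n => Finset.sum_nonneg fun _ _ => abs_nonneg _
  have hanti : Antitone e := by
    refine antitone_nat_of_succ_le fun n => ?_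
    have := contract (convPow ν 1) (d n) 0 (convPow_nonneg ν h0 1) (convPow_sum ν h1 1) (hd0 n)
    rw [← hdadd, Nat.add_comm] at this
    simpa using this
  obtain ⟨N, hN⟩ := exists_pos ν h0 hl hgen
  obtain ⟨x₀, hx₀⟩ := Finite.exists_min (convPow ν N)
  have hcon : ∀ n, e (n + N) ≤ (1 - Fintype.card K * convPow ν N x₀) * e n := by
    intro n
    have := contract (convPow ν N) (d n) _ hx₀ (convPow_sum ν h1 N) (hd0 n)
    rw [← hdadd, Nat.add_comm] at this
    exact this
  have hlim := tendsto_atTop_ciInf hanti ⟨0, by rintro _ ⟨n, rfl⟩; exact he0 n⟩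
  set l := ⨅ i, e i
  have hl0 : 0 ≤ l := ge_of_tendsto' hlim he0
  have hle : l ≤ (1 - Fintype.card K * convPow ν N x₀) * l :=
    le_of_tendsto_of_tendsto' (hlim.comp (tendsto_add_atTop_nat N)) (hlim.const_mul _) hcon
  have hpos : 0 < (Fintype.card K : ℝ) * convPow ν N x₀ :=
    mul_pos (by exact_mod_cast Fintype.card_pos) (hN x₀)
  have hlz : l = 0 := by nlinarith
  rw [hlz] at hlim
  rw [tendsto_iff_norm_sub_tendsto_zero]
  refine squeeze_zero (fun _ => norm_nonneg _) (fun n => ?_) hlim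
  exact Finset.single_le_sum (f := fun x => |d n x|) (fun _ _ => abs_nonneg _) (Finset.mem_univ g)

lemma entropy_tendsto (ν : K → ℝ) (h0 : ∀ x, 0 ≤ ν x) (h1 : ∑ x, ν x = 1) (hl : 0 < ν 1)
    (hgen : Subgroup.closure (Function.support ν) = ⊤) :
    Tendsto (fun n => entropy (convPow ν n)) atTop (nhds (Real.log (Fintype.card K))) := by
  have hc : (Fintype.card K : ℝ) ≠ 0 := by exact_mod_cast Fintype.card_ne_zero
  have h := (tendsto_finsetSum (Finset.univ : Finset K) fun g _ =>
    (Real.continuous_mul_log.tendsto _).comp (convPow_tendsto ν h0 h1 hl hgen g)).neg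
  simp only [entropy, tsum_fintype]
  have hval : Real.log (Fintype.card K) =
      -∑ _c : K, (Fintype.card K : ℝ)⁻¹ * Real.log (Fintype.card K : ℝ)⁻¹ := by
    rw [Finset.sum_const, Finset.card_univ, nsmul_eq_mul, Real.log_inv]
    field_simp
  rw [hval]
  exact h

end helpers

/-- Any finite group with at least two elements and a lazy
generating measure is entropy noise sensitive. -/
theorem finite_group_entropyNS {G : Type*} [Group G] [Finite G] [Nontrivial G]
    (μ : G → ℝ) (hprob : IsProbMeasure μ) (hlazy : 0 < μ 1)
    (hgen : Subgroup.closure (Function.support μ) = ⊤) :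
    EntropyNoiseSensitive μ := by
  classical
  haveI := Fintype.ofFinite G
  obtain ⟨h0, h1⟩ := hprob
  rw [tsum_fintype] at h1
  rintro ρ ⟨hρ0, hρ1⟩
  have hρ1' : 0 < 1 - ρ := sub_pos.2 hρ1
  have hA := entropy_tendsto μ h0 h1 hlazy hgen
  have hdiag0 : ∀ p, 0 ≤ diagM μ p := fun p => Set.indicator_nonneg (fun _ _ => h0 _) p
  have hB := entropy_tendsto (noise μ ρ) ?_ ?_ ?_ ?_
  · have hcard : (1 : ℝ) < Fintype.card G := by exact_mod_cast Fintype.one_lt_card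
    have hlog := (Real.log_pos hcard).ne'
    have := (hB.sub hA).div hA hlog
    have hval : (Real.log (Fintype.card (G × G)) - Real.log (Fintype.card G)) /
        Real.log (Fintype.card G) = 1 := by
      rw [Fintype.card_prod]
      push_cast
      rw [Real.log_mul (by positivity) (by positivity), add_sub_cancel_right, div_self hlog]
    rw [hval] at this
    exact this
  · intro p
    exact add_nonneg (mul_nonneg hρ1'.le (hdiag0 p))
      (mul_nonneg hρ0.le (mul_nonneg (h0 _) (h0 _)))
  · have e1 : ∑ p, diagM μ p = 1 := by
      simp [Fintype.sum_prod_type, diagM, Set.indicator_apply, h1]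
    have e2 : ∑ p : G × G, prodM μ μ p = 1 := by
      simp [Fintype.sum_prod_type, prodM, ← Finset.mul_sum, h1]
    simp only [noise, Finset.sum_add_distrib, ← Finset.mul_sum, e1, e2]
    ring
  · have : 0 < ρ * prodM μ μ 1 := mul_pos hρ0 (mul_pos hlazy hlazy)
    exact add_pos_of_nonneg_of_pos (mul_nonneg hρ1'.le (hdiag0 _)) this
  · rw [eq_top_iff]
    have hsub : Function.support μ ×ˢ Function.support μ ⊆ Function.support (noise μ ρ) := by
      rintro ⟨x, y⟩ ⟨hx, hy⟩
      have hx' : 0 < μ x := lt_of_le_of_ne (h0 x) (Ne.symm hx)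
      have hy' : 0 < μ y := lt_of_le_of_ne (h0 y) (Ne.symm hy)
      have : 0 < ρ * prodM μ μ (x, y) := mul_pos hρ0 (mul_pos hx' hy')
      exact (add_pos_of_nonneg_of_pos (mul_nonneg hρ1'.le (hdiag0 _)) this).ne'
    refine le_trans ?_ (Subgroup.closure_mono hsub)
    rw [Subgroup.closure_prod hlazy.ne' hlazy.ne', hgen, Subgroup.top_prod_top]

end NS
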